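/- Let λ ∈ [0,1) be a discount factor, s₀ ∈ S a state, and x, x' two stationary strategies of the unique player. For each α ∈ [0,1] let x_α be a stationary strategy satisfying t_λ(s₀,x_α;s,a) = α·t_λ(s₀,x;s,a) + (1-α)·t_λ(s₀,x';s,a) for all state-action pairs (s,a) (such x_α exists by Altman's theorem, and is uniquely determined at every state visited with positive discounted time). Then for every state s with t_λ(s₀,x;{s}) + t_λ(s₀,x';{s}) > 0 and every action a ∈ A^i(s), the map α ↦ x_α(s;a) is monotone (nondecreasing or nonincreasing) on [0,1]. -/

import Mathlib

open MeasureTheory Filter Topology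
open scoped ENNReal

noncomputable section

/-- A finite stochastic game: a finite set of players `I`, a finite set of states `S`,
finite nonempty action sets `A i s`, stage payoffs `u` bounded by `1` in absolute value,
and transition probabilities `q`. -/
structure StocGame where
  (I : Type)
  (S : Type)
  (A : I → S → Type)
  [fintypeI : Fintype I]
  [fintypeS : Fintype S]
  [decI : DecidableEq I]
  [decS : DecidableEq S]
  [fintypeA : ∀ i s, Fintype (A i s)]
  [decA : ∀ i s, DecidableEq (A i s)]
  [nonemptyA : ∀ i s, Nonempty (A i s)]
  (u : I → (s : S) → ((j : I) → A j s) → ℝ)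
  (u_bdd : ∀ i s a, |u i s a| ≤ 1)
  (q : (s : S) → ((j : I) → A j s) → S → ℝ)
  (q_nonneg : ∀ s a s', 0 ≤ q s a s')
  (q_sum : ∀ s a, ∑ s', q s a s' = 1)

namespace StocGame

attribute [instance] fintypeI fintypeS decI decS fintypeA decA nonemptyA

/-- A mixed action over a finite set of actions. -/
abbrev Mixed (α : Type) [Fintype α] : Type := {f : α → ℝ // (∀ a, 0 ≤ f a) ∧ ∑ a, f a = 1}

variable {G : StocGame}

/-- Action profiles available at state `s`. -/
abbrev Prof (G : StocGame) (s : G.S) : Type := (j : G.I) → G.A j s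

/-- A pair of a state together with an action profile at that state. -/
abbrev Step (G : StocGame) : Type := Σ s : G.S, G.Prof s

/-- A finite history: a (reversed) list of past (state, action profile) steps,
together with the current state. -/
abbrev Hist (G : StocGame) : Type := List G.Step × G.S

/-- A behavior strategy of player `i`. -/
abbrev BStrat (G : StocGame) (i : G.I) : Type := (h : G.Hist) → Mixed (G.A i h.2)

/-- A (behavior) strategy profile. -/
abbrev Profile (G : StocGame) : Type := (i : G.I) → G.BStrat i

/-- A stationary strategy of player `i`. -/
abbrev Stat (G : StocGame) (i : G.I) : Type := (s : G.S) → Mixed (G.A i s)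

/-- A stationary strategy profile. -/
abbrev StatProf (G : StocGame) : Type := (i : G.I) → G.Stat i

/-- The behavior strategy profile induced by a stationary strategy profile. -/
def toB (x : G.StatProf) : G.Profile := fun i h => x i h.2

/-- The behavior strategy induced by a stationary strategy. -/
def toB1 {i : G.I} (x : G.Stat i) : G.BStrat i := fun h => x h.2

/-- A stationary strategy profile is pure if at every state each player
puts probability `1` on a single action. -/
def IsPureStat (x : G.StatProf) : Prop :=
  ∀ (i : G.I) (s : G.S), ∃ a : G.A i s, ∀ b, (x i s).1 b = if b = a then 1 else 0

/-- The probability, under strategy profile `σ` and initial state `s0`, that the play follows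
the finite history whose (reversed) list of steps is the first argument and whose current
state is the second argument. -/
def probHistAux (s0 : G.S) (σ : G.Profile) : List G.Step → G.S → ℝ
  | [], s => if s = s0 then 1 else 0
  | ⟨s', a⟩ :: rest, s =>
      probHistAux s0 σ rest s' * (∏ i, (σ i (rest, s')).1 (a i)) * G.q s' a s

/-- The probability that the play follows the finite history `h`. -/
def probHist (s0 : G.S) (σ : G.Profile) (h : G.Hist) : ℝ := probHistAux s0 σ h.1 h.2

/-- The expected `lam`-discounted time `t_lam(s0,σ;s,a)` that the play spends at the
state-action pair `st = (s,a)`. -/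
def tStep (lam : ℝ) (s0 : G.S) (σ : G.Profile) (st : G.Step) : ℝ :=
  (1 - lam) *
    ∑' h : G.Hist, (if h.1.head? = some st then lam ^ (h.1.length - 1) * probHist s0 σ h else 0)

/-- The expected `lam`-discounted time that the play spends in the set of states `D`. -/
def tSet (lam : ℝ) (s0 : G.S) (σ : G.Profile) (D : Finset G.S) : ℝ :=
  ∑ st : G.Step, if st.1 ∈ D then tStep lam s0 σ st else 0

/-- The `lam`-discounted (unnormalized) payoff `U^i_lam(s0,σ;D)` that player `i` receives
while the play is in `D`. -/
def UD (lam : ℝ) (s0 : G.S) (σ : G.Profile) (i : G.I) (D : Finset G.S) : ℝ :=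
  ∑ st : G.Step, if st.1 ∈ D then tStep lam s0 σ st * G.u i st.1 st.2 else 0

/-- The `lam`-discounted payoff of player `i`. -/
def payoffD (lam : ℝ) (s0 : G.S) (σ : G.Profile) (i : G.I) : ℝ :=
  ∑ st : G.Step, tStep lam s0 σ st * G.u i st.1 st.2

/-- `Di` is a partition of the set of states. -/
def IsPartitionF (Di : Finset (Finset G.S)) : Prop :=
  ∀ s : G.S, ∃! D : Finset G.S, D ∈ Di ∧ s ∈ D

/-- The payoff of player `i` in the modified game, given the partition `Di` and
the cutoffs `c`. -/
def modPayoff (lam : ℝ) (s0 : G.S) (σ : G.Profile) (i : G.I)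
    (Di : Finset (Finset G.S)) (c : Finset G.S → ℝ) : ℝ :=
  ∑ D ∈ Di, min (UD lam s0 σ i D) (tSet lam s0 σ D * c D)

/-- The `lam`-discounted min-max value of player `i` in the original game. -/
def minmaxOrig (G : StocGame) (lam : ℝ) (s0 : G.S) (i : G.I) : ℝ :=
  ⨅ σ : G.Profile, ⨆ σi : G.BStrat i, payoffD lam s0 (Function.update σ i σi) i

/-- The `lam`-discounted max-min value of player `i` in the original game. -/
def maxminOrig (G : StocGame) (lam : ℝ) (s0 : G.S) (i : G.I) : ℝ :=
  ⨆ σi : G.BStrat i, ⨅ σ : G.Profile, payoffD lam s0 (Function.update σ i σi) i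

/-- The min-max value of player `i` in the modified game. -/
def minmaxMod (G : StocGame) (lam : ℝ) (s0 : G.S) (i : G.I)
    (Di : Finset (Finset G.S)) (c : Finset G.S → ℝ) : ℝ :=
  ⨅ σ : G.Profile, ⨆ σi : G.BStrat i,
    modPayoff lam s0 (Function.update σ i σi) i Di c

/-- The max-min value of player `i` in the modified game. -/
def maxminMod (G : StocGame) (lam : ℝ) (s0 : G.S) (i : G.I)
    (Di : Finset (Finset G.S)) (c : Finset G.S → ℝ) : ℝ :=
  ⨆ σi : G.BStrat i, ⨅ σ : G.Profile,
    modPayoff lam s0 (Function.update σ i σi) i Di c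

/-- The min-max value in stationary strategies of player `i` in the modified game. -/
def minmaxModStat (G : StocGame) (lam : ℝ) (s0 : G.S) (i : G.I)
    (Di : Finset (Finset G.S)) (c : Finset G.S → ℝ) : ℝ :=
  ⨅ x : G.StatProf, ⨆ xi : G.Stat i,
    modPayoff lam s0 (Function.update (toB x) i (toB1 xi)) i Di c

/-- The max-min value in stationary strategies of player `i` in the modified game. -/
def maxminModStat (G : StocGame) (lam : ℝ) (s0 : G.S) (i : G.I)
    (Di : Finset (Finset G.S)) (c : Finset G.S → ℝ) : ℝ :=
  ⨆ xi : G.Stat i, ⨅ x : G.StatProf,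
    modPayoff lam s0 (Function.update (toB x) i (toB1 xi)) i Di c

/-! ### Plays and the induced measure -/

/-- A play: the infinite sequence of (state, action profile) pairs. -/
abbrev Play (G : StocGame) : Type := ℕ → G.Step

instance : MeasurableSpace G.Step := ⊤

/-- The finite history consisting of the first `n` stages of the play `p`
(reversed list of the first `n` steps, together with the state at stage `n`). -/
def histOf (p : G.Play) : ℕ → G.Hist
  | 0 => ([], (p 0).1)
  | n + 1 => ((p n) :: (histOf p n).1, (p (n + 1)).1)

/-- The cylinder set of plays whose initial segment is the finite history `h`. -/
def cylSet (h : G.Hist) : Set G.Play := {p | histOf p h.1.length = h}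

/-- `μfam` is the family of probability measures on plays induced (via the
Ionescu–Tulcea theorem) by the initial state and the strategy profile:
it is characterized by being a probability measure giving each cylinder set
the probability of the corresponding finite history. -/
def IsInduced (μfam : G.S → G.Profile → Measure G.Play) : Prop :=
  (∀ s0 σ, IsProbabilityMeasure (μfam s0 σ)) ∧
  ∀ (s0 : G.S) (σ : G.Profile) (h : G.Hist),
    μfam s0 σ (cylSet h) = ENNReal.ofReal (probHist s0 σ h)

/-- A bounded stopping time (with respect to the filtration generated by finite histories). -/
def IsBddST (τ : G.Play → ℕ) : Prop :=
  (∃ B, ∀ p, τ p ≤ B) ∧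
  ∀ p p' n, τ p = n → histOf p n = histOf p' n → τ p' = n

/-- Two states lie in the same element of the partition `Di`. -/
def sameOf (Di : Finset (Finset G.S)) (s s' : G.S) : Prop := ∃ D ∈ Di, s ∈ D ∧ s' ∈ D

open Classical in
/-- The number of switches between elements of a partition along a play,
where the partition is described through the relation `r` ("being in the same element"). -/
def Zsw (r : G.S → G.S → Prop) (p : G.Play) : ℝ≥0∞ :=
  ∑' n : ℕ, if r (p n).1 (p (n + 1)).1 then 0 else 1

/-- The stopping times `τ^𝒟_k` indicating when the play moves from one element of
the partition (described by the relation `r`) to another. -/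
def switchT (r : G.S → G.S → Prop) (p : G.Play) : ℕ → ℕ∞
  | 0 => 0
  | k + 1 => sInf {n : ℕ∞ | ∃ m : ℕ, n = (m : ℕ∞) ∧ switchT r p k < (m : ℕ∞) ∧
      ¬ r (p (m - 1)).1 (p m).1}

/-- The expected average payoff of player `i` in the `N`-stage game. -/
def payoffN (μfam : G.S → G.Profile → Measure G.Play) (N : ℕ) (s0 : G.S)
    (σ : G.Profile) (i : G.I) : ℝ :=
  (∫ p, (∑ n ∈ Finset.range N, G.u i (p n).1 (p n).2) ∂(μfam s0 σ)) / N

/-- `σi` is a uniform `ε`-max-min strategy of player `i` (with respect to the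
uniform max-min value function `v`). -/
def UnifMaxMin (μfam : G.S → G.Profile → Measure G.Play) (v : G.S → ℝ) (i : G.I)
    (σi : G.BStrat i) (ε : ℝ) : Prop :=
  ∃ lam0 : ℝ, 0 ≤ lam0 ∧ lam0 < 1 ∧ ∃ N0 : ℕ,
    ∀ (s0 : G.S) (σ : G.Profile),
      (∀ lam : ℝ, lam0 < lam → lam < 1 →
        v s0 - ε ≤ payoffD lam s0 (Function.update σ i σi) i) ∧
      (∀ τ : G.Play → ℕ, IsBddST τ →
        (N0 : ℝ) ≤ ∫ p, (τ p : ℝ) ∂(μfam s0 (Function.update σ i σi)) →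
        (v s0 - ε) * ∫ p, (τ p : ℝ) ∂(μfam s0 (Function.update σ i σi)) ≤
          ∫ p, (∑ n ∈ Finset.range (τ p), G.u i (p n).1 (p n).2)
            ∂(μfam s0 (Function.update σ i σi)))

/-- `σi` is `(𝒟,ε)`-max-min preserving, where the partition `𝒟` is described by the
relation `r`, and the conditional-expectation requirement is expressed through
integrals over the atoms (cylinder sets) of the σ-algebra of the stopping time `τ^𝒟_k`. -/
def PreservingPart (μfam : G.S → G.Profile → Measure G.Play) (v : G.S → ℝ)
    (r : G.S → G.S → Prop) (i : G.I) (σi : G.BStrat i) (ε : ℝ) : Prop :=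
  ∀ (s0 : G.S) (σ : G.Profile) (k : ℕ) (τ' : G.Play → ℕ), IsBddST τ' →
    (∀ p, switchT r p k ≠ ⊤ →
      switchT r p k < (τ' p : ℕ∞) ∧ (τ' p : ℕ∞) ≤ switchT r p (k + 1)) →
    ∀ h : G.Hist, (∀ p ∈ cylSet h, switchT r p k = (h.1.length : ℕ∞)) →
      ∫ p in cylSet h, (v h.2 - ε) ∂(μfam s0 (Function.update σ i σi)) ≤
        ∫ p in cylSet h, v ((p (τ' p)).1) ∂(μfam s0 (Function.update σ i σi))

/-- `σi` is `ε`-max-min preserving (with respect to arbitrary bounded stopping times);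
again the conditional-expectation requirement is expressed through integrals over the
atoms of the σ-algebra of the stopping time `τ`. -/
def PreservingST (μfam : G.S → G.Profile → Measure G.Play) (v : G.S → ℝ) (i : G.I)
    (σi : G.BStrat i) (ε : ℝ) : Prop :=
  ∀ (s0 : G.S) (σ : G.Profile) (τ τ' : G.Play → ℕ), IsBddST τ → IsBddST τ' →
    (∀ p, τ p < τ' p) →
    ∀ h : G.Hist, (∀ p ∈ cylSet h, τ p = h.1.length) →
      ∫ p in cylSet h, (v h.2 - ε) ∂(μfam s0 (Function.update σ i σi)) ≤
        ∫ p in cylSet h, v ((p (τ' p)).1) ∂(μfam s0 (Function.update σ i σi))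

/-- A history enters a new element of the partition (described by `r`) at its final stage. -/
def entersNew (r : G.S → G.S → Prop) (h : G.Hist) : Prop :=
  match h.1 with
  | [] => True
  | st :: _ => ¬ r st.1 h.2

/-- `σi` is `𝒟`-Markovian: its continuation strategy coincides after any two finite histories
that end at the same state and whose final stage enters a new element of the partition
(described by `r`). -/
def Markovian (r : G.S → G.S → Prop) {i : G.I} (σi : G.BStrat i) : Prop :=
  ∀ h h' : G.Hist, h.2 = h'.2 → entersNew r h → entersNew r h' →
    ∀ (l : List G.Step) (s'' : G.S), σi (l ++ h.1, s'') = σi (l ++ h'.1, s'')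

open Classical in
/-- The portion of the history since the last time the play entered a new element of the
partition (described by `r`): (reversed) list of steps, given the current state. -/
def philist (r : G.S → G.S → Prop) : List G.Step → G.S → List G.Step
  | [], _ => []
  | st :: rest, s => if r st.1 s then st :: philist r rest st.1 else []

/-- The restart strategy `σ^i_𝒟`: whenever the play enters a new element of the partition
(described by `r`), player `i` forgets past play and restarts playing `σi`. -/
def restart {i : G.I} (σi : G.BStrat i) (r : G.S → G.S → Prop) : G.BStrat i :=
  fun h => σi (philist r h.1 h.2, h.2)

/-- The partition `Di` satisfies Property P with respect to player `i`
(whose uniform max-min value function is `v`). -/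
def PropertyP (μfam : G.S → G.Profile → Measure G.Play) (v : G.S → ℝ) (i : G.I)
    (Di : Finset (Finset G.S)) : Prop :=
  ∃ ζ : ℝ, 0 < ζ ∧ ∀ ε : ℝ, 0 < ε → ∃ σi : G.BStrat i,
    Markovian (sameOf Di) σi ∧ UnifMaxMin μfam v i σi ε ∧
    ∀ (s0 : G.S) (σ : G.Profile), ∃ E : Set G.Play,
      ENNReal.ofReal (1 - ε) < μfam s0 (Function.update σ i σi) E ∧
      ∫⁻ p in E, Zsw (sameOf Di) p ∂(μfam s0 (Function.update σ i σi)) ≤ ENNReal.ofReal ζ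

/-- The strategy profile `σ` (whose `i`-th coordinate is the strategy of player `i`) makes
player `i`'s strategy a uniform `𝒟`-subgame-perfect `ε`-min-max strategy against the others'
strategies, at the initial state `s0`; `vbar` is the uniform min-max value function of
player `i`, and the partition `𝒟` is described by the relation `r`.  Conditional-expectation
requirements are expressed through integrals over the atoms (cylinder sets) of the σ-algebra
of the stopping time `τ^𝒟_k`. -/
def SubgamePerfect (μfam : G.S → G.Profile → Measure G.Play) (vbar : G.S → ℝ)
    (r : G.S → G.S → Prop) (i : G.I) (σ : G.Profile) (s0 : G.S) (ε : ℝ) : Prop :=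
  ∃ N0 : ℕ, 0 < N0 ∧
    (∀ N : ℕ, N0 ≤ N → vbar s0 - ε ≤ payoffN μfam N s0 σ i) ∧
    (∀ (k : ℕ) (τ : G.Play → ℕ), IsBddST τ → (∀ p, switchT r p k ≤ (τ p : ℕ∞)) →
      ∀ h : G.Hist, (∀ p ∈ cylSet h, switchT r p k = (h.1.length : ℕ∞)) →
        (∫ p in cylSet h, (vbar h.2 - ε) ∂(μfam s0 σ) ≤
          ∫ p in cylSet h, vbar ((p (τ p)).1) ∂(μfam s0 σ)) ∧
        ((N0 : ℝ) * (μfam s0 σ (cylSet h)).toReal ≤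
            ∫ p in cylSet h, ((τ p : ℝ) - (h.1.length : ℝ)) ∂(μfam s0 σ) →
          (vbar h.2 - ε) * ∫ p in cylSet h, ((τ p : ℝ) - (h.1.length : ℝ)) ∂(μfam s0 σ) ≤
            ∫ p in cylSet h, (∑ n ∈ Finset.Ico h.1.length (τ p), G.u i (p n).1 (p n).2)
              ∂(μfam s0 σ)))

/-- The partition `Di` satisfies Property P' with respect to player `i`
(whose uniform min-max value function is `vbar`). -/
def PropertyP' (μfam : G.S → G.Profile → Measure G.Play) (vbar : G.S → ℝ) (i : G.I)
    (Di : Finset (Finset G.S)) : Prop :=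
  ∃ ζ : ℝ, 0 < ζ ∧ ∀ ε : ℝ, 0 < ε → ∀ (s0 : G.S) (σ : G.Profile), ∃ σi : G.BStrat i,
    SubgamePerfect μfam vbar (sameOf Di) i (Function.update σ i σi) s0 ε ∧
    ∃ E : Set G.Play,
      ENNReal.ofReal (1 - ε) ≤ μfam s0 (Function.update σ i σi) E ∧
      ∫⁻ p in E, Zsw (sameOf Di) p ∂(μfam s0 (Function.update σ i σi)) ≤ ENNReal.ofReal ζ

/-! ### Reachability, closed and strongly controllable sets -/

/-- The first arrival time to the set of states `C`. -/
def hitT (C : Set G.S) (p : G.Play) : ℕ∞ :=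
  sInf {n : ℕ∞ | ∃ m : ℕ, n = (m : ℕ∞) ∧ (p m).1 ∈ C}

/-- State `s` leads in `D` to state `s'`. -/
def LeadsIn (μfam : G.S → G.Profile → Measure G.Play) (D : Set G.S) (s s' : G.S) : Prop :=
  ∃ σ : G.Profile, μfam s σ {p | hitT {s'} p < hitT Dᶜ p} = 1

/-- The states `s` and `s'` are `D`-siblings. -/
def Siblings (μfam : G.S → G.Profile → Measure G.Play) (D : Set G.S) (s s' : G.S) : Prop :=
  LeadsIn μfam D s s' ∧ LeadsIn μfam D s' s

/-- The probability `q(D | s, a)` that the next state lies in `D`. -/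
def qOf (D : Set G.S) (s : G.S) (a : G.Prof s) : ℝ := ∑ s', D.indicator (G.q s a) s'

/-- The set of states `D` is closed. -/
def ClosedSet (G : StocGame) (D : Set G.S) : Prop :=
  ∀ s ∈ D, ∀ a : G.Prof s, qOf D s a = 1

/-- The set of states `D` is strongly controllable. -/
def StronglyContr (G : StocGame) (D : Set G.S) : Prop :=
  ∃ iD : G.I, ∃ sD ∈ D, ∃ atil : G.A iD sD,
    ∀ s ∈ D, ∀ a : G.Prof s, qOf D s a < 1 → s = sD ∧ HEq (a iD) atil

/-- The element of the partition `𝒟` (by the vector of uniform min-max values `v`)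
that contains the state `s`. -/
def Dv (v : G.I → G.S → ℝ) (s : G.S) : Set G.S := {s' | ∀ i, v i s' = v i s}

/-- The element of the refined partition `𝒟*` (refining `𝒟` by the `D`-siblings relation)
that contains the state `s`. -/
def DstarCl (μfam : G.S → G.Profile → Measure G.Play) (v : G.I → G.S → ℝ) (s : G.S) :
    Set G.S := {s' | s' ∈ Dv v s ∧ Siblings μfam (Dv v s) s s'}

/-- The stochastic game is strongly controllable: every element of `𝒟*` is either closed
or strongly controllable. -/
def StronglyControllableGame (G : StocGame) (μfam : G.S → G.Profile → Measure G.Play)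
    (v : G.I → G.S → ℝ) : Prop :=
  ∀ s : G.S, ClosedSet G (DstarCl μfam v s) ∨ StronglyContr G (DstarCl μfam v s)

end StocGame

/-- A set `X ⊆ ℝ^ι` is monovex if every two points of `X` are connected by a continuous
path inside `X` all of whose coordinates are monotone. -/
def Monovex {ι : Type} (X : Set (ι → ℝ)) : Prop :=
  ∀ x ∈ X, ∀ y ∈ X, ∃ f : ℝ → ι → ℝ,
    ContinuousOn f (Set.Icc 0 1) ∧ (∀ t ∈ Set.Icc (0 : ℝ) 1, f t ∈ X) ∧
    f 0 = x ∧ f 1 = y ∧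
    ∀ j : ι, MonotoneOn (fun t => f t j) (Set.Icc 0 1) ∨
      AntitoneOn (fun t => f t j) (Set.Icc 0 1)

end

/-- Summing `c ⊗ q` over a product with a finite factor on which `q` has mass one gives `∑' c`,
whether or not `c` is summable. -/
theorem tsum_prod_mul_of_sum_eq_one {β γ : Type*} [Fintype γ] (c : β → ℝ) (q : γ → ℝ)
    (hq : ∑ y, q y = 1) : ∑' p : β × γ, c p.1 * q p.2 = ∑' b, c b := by
  by_cases hc : Summable c
  · have h : Summable fun p : β × γ => c p.1 * q p.2 :=
      summable_mul_of_summable_norm hc.norm (Summable.of_finite (f := fun y => ‖q y‖))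
    rw [h.tsum_prod]
    simp only [tsum_fintype, ← Finset.mul_sum, hq, mul_one]
  · have h : ¬ Summable fun p : β × γ => c p.1 * q p.2 := by
      intro h
      obtain ⟨y, hy⟩ : ∃ y, q y ≠ 0 := by
        by_contra! h0
        simp [h0] at hq
      refine hc ((summable_mul_right_iff hy).1 ?_)
      exact h.comp_injective (i := fun b => (b, y)) fun _ _ hb => congrArg Prod.fst hb
    rw [tsum_eq_zero_of_not_summable h, tsum_eq_zero_of_not_summable hc]

/-- A weighted average of two reals, with weights affine in `α`, is monotone in `α`; its value is
unconstrained wherever the total weight vanishes. -/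
theorem monotoneOn_or_antitoneOn_of_weighted_average {W W' p p' : ℝ} {f : ℝ → ℝ}
    (hW : 0 ≤ W) (hW' : 0 ≤ W') (hpos : 0 < W + W')
    (hf : ∀ α ∈ Set.Icc (0 : ℝ) 1,
      (α * W + (1 - α) * W') * f α = α * (W * p) + (1 - α) * (W' * p')) :
    MonotoneOn f (Set.Icc 0 1) ∨ AntitoneOn f (Set.Icc 0 1) := by
  rcases hW'.eq_or_lt with h0 | hW'pos
  · subst h0
    have hW0 : W ≠ 0 := by linarith
    have hc : ∀ α ∈ Set.Icc (0 : ℝ) 1, α ≠ 0 → f α = p := by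
      intro α hα hne
      have := hf α hα
      refine mul_left_cancel₀ (mul_ne_zero hne hW0) ?_
      linarith
    rcases le_total (f 0) p with h | h
    · left
      intro α hα β hβ hab
      rcases eq_or_ne β 0 with rfl | hβ0
      · rw [le_antisymm hab hα.1]
      · rcases eq_or_ne α 0 with rfl | hα0
        · rwa [hc β hβ hβ0]
        · rw [hc α hα hα0, hc β hβ hβ0]
    · right
      intro α hα β hβ hab
      rcases eq_or_ne β 0 with rfl | hβ0
      · rw [le_antisymm hab hα.1]
      · rcases eq_or_ne α 0 with rfl | hα0
        · rwa [hc β hβ hβ0]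
        · rw [hc α hα hα0, hc β hβ hβ0]
  rcases hW.eq_or_lt with h0 | hWpos
  · subst h0
    have hc : ∀ α ∈ Set.Icc (0 : ℝ) 1, α ≠ 1 → f α = p' := by
      intro α hα hne
      have := hf α hα
      refine mul_left_cancel₀ (mul_ne_zero (sub_ne_zero.2 hne.symm) hW'pos.ne') ?_
      linarith
    rcases le_total p' (f 1) with h | h
    · left
      intro α hα β hβ hab
      rcases eq_or_ne α 1 with rfl | hα1
      · rw [le_antisymm hab hβ.2]
      · rcases eq_or_ne β 1 with rfl | hβ1
        · rwa [hc α hα hα1]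
        · rw [hc α hα hα1, hc β hβ hβ1]
    · right
      intro α hα β hβ hab
      rcases eq_or_ne α 1 with rfl | hα1
      · rw [le_antisymm hab hβ.2]
      · rcases eq_or_ne β 1 with rfl | hβ1
        · rwa [hc α hα hα1]
        · rw [hc α hα hα1, hc β hβ hβ1]
  have hD : ∀ α ∈ Set.Icc (0 : ℝ) 1, 0 < α * W + (1 - α) * W' := by
    intro α hα
    rcases hα.1.eq_or_lt with h | h
    · subst h; simpa using hW'pos
    · have := mul_pos h hWpos
      have := mul_nonneg (sub_nonneg.2 hα.2) hW'
      linarith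
  have hfe : ∀ α ∈ Set.Icc (0 : ℝ) 1,
      f α = (α * (W * p) + (1 - α) * (W' * p')) / (α * W + (1 - α) * W') := by
    intro α hα
    rw [eq_div_iff (hD α hα).ne', ← hf α hα, mul_comm]
  have hcross : ∀ α β : ℝ,
      (β * (W * p) + (1 - β) * (W' * p')) * (α * W + (1 - α) * W') -
        (α * (W * p) + (1 - α) * (W' * p')) * (β * W + (1 - β) * W') =
      W * W' * (β - α) * (p - p') := by
    intro α β; ring
  rcases le_total p' p with h | h
  · left
    intro α hα β hβ hab
    rw [hfe α hα, hfe β hβ, div_le_div_iff₀ (hD α hα) (hD β hβ)]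
    have := mul_nonneg (mul_nonneg (mul_nonneg hW hW') (sub_nonneg.2 hab)) (sub_nonneg.2 h)
    linarith [hcross α β]
  · right
    intro α hα β hβ hab
    rw [hfe α hα, hfe β hβ, div_le_div_iff₀ (hD β hβ) (hD α hα)]
    have := mul_nonneg (mul_nonneg (mul_nonneg hW hW') (sub_nonneg.2 hab)) (sub_nonneg.2 h)
    linarith [hcross α β]

namespace StocGame

theorem probHistAux_nonneg {G : StocGame} (s0 : G.S) (σ : G.Profile) (l : List G.Step) (s : G.S) :
    0 ≤ probHistAux s0 σ l s := by
  induction l generalizing s with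
  | nil => rw [probHistAux]; split_ifs <;> norm_num
  | cons st rest ih =>
    obtain ⟨s', a⟩ := st
    rw [probHistAux]
    exact mul_nonneg (mul_nonneg (ih s') (Finset.prod_nonneg fun i _ => (σ i _).2.1 _))
      (G.q_nonneg _ _ _)

/-- The expected discounted time spent at the state `s`, as a sum over histories ending at `s`. -/
noncomputable def stateTime {G : StocGame} (lam : ℝ) (s0 : G.S) (σ : G.Profile) (s : G.S) : ℝ :=
  (1 - lam) * ∑' l : List G.Step, lam ^ l.length * probHistAux s0 σ l s

theorem stateTime_nonneg {G : StocGame} {lam : ℝ} (hlam0 : 0 ≤ lam) (hlam1 : lam ≤ 1) (s0 : G.S)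
    (σ : G.Profile) (s : G.S) : 0 ≤ stateTime lam s0 σ s :=
  mul_nonneg (sub_nonneg.2 hlam1) (tsum_nonneg fun l =>
    mul_nonneg (pow_nonneg hlam0 _) (probHistAux_nonneg s0 σ l s))

theorem tStep_toB {G : StocGame} (lam : ℝ) (s0 : G.S) (y : G.StatProf) (s : G.S) (b : G.Prof s) :
    tStep lam s0 (toB y) ⟨s, b⟩ = stateTime lam s0 (toB y) s * ∏ i, (y i s).1 (b i) := by
  rw [tStep, stateTime, mul_assoc]
  congr 1
  have hinj : Function.Injective
      fun p : List G.Step × G.S => ((⟨s, b⟩ :: p.1, p.2) : G.Hist) := by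
    rintro ⟨l, t⟩ ⟨l', t'⟩ h
    simpa using h
  refine (hinj.tsum_eq ?_).symm.trans ?_
  · rintro ⟨l, t⟩ h
    cases l with
    | nil => simp at h
    | cons st rest =>
      have hst : st = ⟨s, b⟩ := by
        by_contra hne
        simp [hne] at h
      exact ⟨(rest, t), by rw [hst]⟩
  · refine Eq.trans ?_ tsum_mul_right
    refine Eq.trans ?_ (tsum_prod_mul_of_sum_eq_one _ (G.q s b) (G.q_sum s b))
    refine tsum_congr fun p => ?_
    simp [probHist, probHistAux, toB]
    ring

theorem sum_prod_mixed_eq_one {G : StocGame} (y : G.StatProf) (s : G.S) :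
    ∑ b : G.Prof s, ∏ i, (y i s).1 (b i) = 1 := by
  rw [← Fintype.prod_sum]
  exact Finset.prod_eq_one fun i _ => (y i s).2.2

theorem sum_tStep_toB {G : StocGame} (lam : ℝ) (s0 : G.S) (y : G.StatProf) (s : G.S) :
    ∑ b : G.Prof s, tStep lam s0 (toB y) ⟨s, b⟩ = stateTime lam s0 (toB y) s := by
  simp only [tStep_toB]
  rw [← Finset.mul_sum, sum_prod_mixed_eq_one, mul_one]

theorem tSet_singleton_toB {G : StocGame} (lam : ℝ) (s0 : G.S) (y : G.StatProf) (s : G.S) :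
    tSet lam s0 (toB y) {s} = stateTime lam s0 (toB y) s := by
  rw [tSet, Fintype.sum_sigma, Finset.sum_eq_single s, ← sum_tStep_toB]
  · simp
  · intro s' _ hs'
    simp [hs']
  · simp

end StocGame

open StocGame in
/-- monotonicity of `α ↦ x_α(s;a)` in a Markov decision process. -/
theorem stmt_2 (G : StocGame) (hMDP : ∀ j j' : G.I, j = j')
    (lam : ℝ) (hlam0 : 0 ≤ lam) (hlam1 : lam < 1) (s0 : G.S)
    (x x' : G.StatProf) (xa : ℝ → G.StatProf)
    (hxa : ∀ α ∈ Set.Icc (0 : ℝ) 1, ∀ st : G.Step,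
      tStep lam s0 (toB (xa α)) st =
        α * tStep lam s0 (toB x) st + (1 - α) * tStep lam s0 (toB x') st)
    (s : G.S) (hpos : 0 < tSet lam s0 (toB x) {s} + tSet lam s0 (toB x') {s})
    (i : G.I) (a : G.A i s) :
    MonotoneOn (fun α => (xa α i s).1 a) (Set.Icc 0 1) ∨
      AntitoneOn (fun α => (xa α i s).1 a) (Set.Icc 0 1) := by
  have : Subsingleton G.I := ⟨hMDP⟩
  rw [tSet_singleton_toB, tSet_singleton_toB] at hpos
  let b : G.Prof s := Function.update (fun j => Classical.arbitrary (G.A j s)) i a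
  have hprod : ∀ y : G.StatProf, ∏ j, (y j s).1 (b j) = (y i s).1 a := by
    intro y
    rw [Fintype.prod_subsingleton _ i]
    simp [b]
  refine monotoneOn_or_antitoneOn_of_weighted_average
    (stateTime_nonneg hlam0 hlam1.le s0 (toB x) s) (stateTime_nonneg hlam0 hlam1.le s0 (toB x') s)
    hpos (p := (x i s).1 a) (p' := (x' i s).1 a) fun α hα => ?_
  have hW : stateTime lam s0 (toB (xa α)) s =
      α * stateTime lam s0 (toB x) s + (1 - α) * stateTime lam s0 (toB x') s := by
    simp only [← sum_tStep_toB, hxa α hα, Finset.sum_add_distrib, Finset.mul_sum]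
  have hb := hxa α hα ⟨s, b⟩
  simp only [tStep_toB, hprod] at hb
  rw [← hW, hb]
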